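/- Let N be an odd positive integer. For w ∈ ℤ/Nℤ let w⁰ ∈ ℤ/2Nℤ denote the unique element that reduces to w modulo N and is odd (i.e., reduces to 1 modulo 2); it exists and is unique because N is odd. Let u, v ∈ ℤ/Nℤ be such that v ≠ 0 and (u, v) has order N in (ℤ/Nℤ)² (equivalently, gcd(u₀, v₀, N) = 1 for integer representatives u₀, v₀). Then ∑_{s₁ ∈ ℤ/2Nℤ} ∑_{s₂ ∈ ℤ/2Nℤ} ∑_{α ∈ ℤ/Nℤ} e( (s₁·(u + (α+1)v)⁰ − s₂·(u + (α−1)v)⁰) / (2N) )·B̄₁(s₁/(2N))·B̄₁(s₂/(2N)) = −N/4, where the products s₁·(u+(α+1)v)⁰ and s₂·(u+(α−1)v)⁰ are taken in ℤ/2Nℤ, and for a ∈ ℤ/2Nℤ the quantities e(a/(2N)) and B̄₁(a/(2N)) are computed from any integer representative of a (well defined). -/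

import Mathlib

/-- The periodic first Bernoulli (sawtooth) function: `B1 x = x - ⌊x⌋ - 1/2` for
`x ∉ ℤ`, and `B1 x = 0` for `x ∈ ℤ`. -/
noncomputable def B1 (x : ℝ) : ℝ := if Int.fract x = 0 then 0 else Int.fract x - 1/2

/-- `e x = exp (2πix)`. -/
noncomputable def e (x : ℝ) : ℂ := Complex.exp (2 * Real.pi * Complex.I * x)

lemma aux_S (z : ℂ) (n : ℕ) : (∑ s ∈ Finset.range n, z ^ s * (s : ℂ)) * (z - 1) ^ 2
    = n * z ^ n * (z - 1) - z * (z ^ n - 1) := by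
  induction n with
  | zero => simp
  | succ k ih =>
    rw [Finset.sum_range_succ, add_mul, ih]
    push_cast
    ring

lemma aux_B1 (M s : ℕ) (hs : s < M) :
    (B1 ((s : ℝ) / M) : ℂ) = (s : ℂ) / M - 1 / 2 + if s = 0 then 1 / 2 else 0 := by
  have hM : (0 : ℝ) < M := by exact_mod_cast (by omega : 0 < M)
  have hf : Int.fract ((s : ℝ) / M) = (s : ℝ) / M := by
    rw [Int.fract_eq_self]
    refine ⟨by positivity, ?_⟩
    rw [div_lt_one hM]
    exact_mod_cast hs
  unfold B1
  rw [hf]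
  by_cases h : s = 0
  · subst h; simp
  · have : (s : ℝ) / M ≠ 0 := by
      have : (s : ℝ) ≠ 0 := by exact_mod_cast h
      positivity
    rw [if_neg this, if_neg h]
    push_cast
    ring

lemma aux_F (M : ℕ) (hM : 0 < M) (z : ℂ) (hz : z ^ M = 1) (hz1 : z ≠ 1) :
    ∑ s ∈ Finset.range M, z ^ s * (B1 ((s : ℝ) / M) : ℂ) = (z + 1) / (2 * (z - 1)) := by
  have hz' : z - 1 ≠ 0 := sub_ne_zero.mpr hz1
  have hMC : (M : ℂ) ≠ 0 := by exact_mod_cast hM.ne'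
  have h1 : ∀ s ∈ Finset.range M, z ^ s * (B1 ((s : ℝ) / M) : ℂ)
      = (z ^ s * (s : ℂ)) / M - 1 / 2 * z ^ s + if s = 0 then 1 / 2 else 0 := by
    intro s hs
    rw [aux_B1 M s (Finset.mem_range.mp hs)]
    by_cases h : s = 0
    · subst h; simp
    · simp only [if_neg h]; ring
  rw [Finset.sum_congr rfl h1, Finset.sum_add_distrib, Finset.sum_sub_distrib,
    ← Finset.sum_div, ← Finset.mul_sum, Finset.sum_ite_eq' , if_pos (Finset.mem_range.mpr hM),
    geom_sum_eq hz1, hz]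
  have h2 := aux_S z M
  rw [hz] at h2
  have h3 : (∑ s ∈ Finset.range M, z ^ s * (s : ℂ)) = M / (z - 1) := by
    field_simp
    apply mul_right_cancel₀ hz'
    linear_combination h2
  rw [h3]
  field_simp
  ring

lemma aux_sum (N : ℕ) [NeZero N] (f : ZMod N → ℂ) :
    ∑ α ∈ Finset.range N, f (α : ZMod N) = ∑ a : ZMod N, f a := by
  refine Finset.sum_bij' (fun a _ => (a : ZMod N)) (fun a _ => a.val) ?_ ?_ ?_ ?_ ?_
  · simp
  · intro a _; simpa using ZMod.val_lt a
  · intro a ha; exact ZMod.val_cast_of_lt (Finset.mem_range.mp ha)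
  · intro a _; simp
  · simp

lemma aux_inj (N : ℕ) (hN : Odd N) [NeZero N] (a b : ZMod (2 * N))
    (h1 : ZMod.castHom (dvd_mul_left N 2) (ZMod N) a = ZMod.castHom (dvd_mul_left N 2) (ZMod N) b)
    (h2 : ZMod.castHom (dvd_mul_right 2 N) (ZMod 2) a
      = ZMod.castHom (dvd_mul_right 2 N) (ZMod 2) b) : a = b := by
  have : NeZero (2 * N) := ⟨by have := NeZero.ne N; omega⟩
  rw [← ZMod.natCast_zmod_val a, ← ZMod.natCast_zmod_val b] at h1 h2 ⊢
  rw [map_natCast, map_natCast, ZMod.natCast_eq_natCast_iff] at h1 h2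
  rw [ZMod.natCast_eq_natCast_iff]
  exact (Nat.modEq_and_modEq_iff_modEq_mul (Nat.coprime_two_left.mpr hN)).mp ⟨h2, h1⟩

lemma aux_e (M : ℕ) [NeZero M] (a : ZMod M) :
    e ((a.val : ℝ) / M) = ZMod.stdAddChar a := by
  conv_rhs => rw [← ZMod.natCast_zmod_val a]
  have := ZMod.stdAddChar_coe (N := M) (a.val : ℤ)
  rw [Int.cast_natCast] at this
  rw [this, e]
  push_cast
  congr 1
  ring

theorem stmt10 (N : ℕ) (hN : Odd N) (hNpos : 0 < N)
    -- `L w` is the odd lift `w⁰` of `w` : the unique element of `ℤ/2Nℤ` reducing to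
    -- `w` modulo `N` and to `1` modulo `2`.
    (L : ZMod N → ZMod (2 * N))
    (hL : ∀ w : ZMod N,
      ZMod.castHom (dvd_mul_left N 2) (ZMod N) (L w) = w ∧ (L w).val % 2 = 1)
    (u v : ZMod N) (hv : v ≠ 0) (horder : addOrderOf ((u, v) : ZMod N × ZMod N) = N) :
    ∑ s₁ ∈ Finset.range (2 * N), ∑ s₂ ∈ Finset.range (2 * N), ∑ α ∈ Finset.range N,
      e (((((s₁ : ZMod (2 * N)) * L (u + ((α : ZMod N) + 1) * v)
            - (s₂ : ZMod (2 * N)) * L (u + ((α : ZMod N) - 1) * v)).val : ℕ) : ℝ) / (2 * N)) *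
        (B1 ((s₁ : ℝ) / (2 * N)) : ℂ) * (B1 ((s₂ : ℝ) / (2 * N)) : ℂ)
    = -(N : ℂ) / 4 := by
  have : NeZero N := ⟨hNpos.ne'⟩
  have : NeZero (2 * N) := ⟨by omega⟩
  have hcast : (2 * (N : ℝ)) = ((2 * N : ℕ) : ℝ) := by push_cast; ring
  rw [hcast]
  set ψ : AddChar (ZMod (2 * N)) ℂ := ZMod.stdAddChar with hψ
  have hpar : ∀ w, ZMod.castHom (dvd_mul_right 2 N) (ZMod 2) (L w) = 1 := by
    intro w
    rw [← ZMod.natCast_zmod_val (L w), map_natCast]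
    have : ((1 : ℕ) : ZMod 2) = 1 := by simp
    rw [← this, ZMod.natCast_eq_natCast_iff]
    exact (hL w).2
  have hne : ∀ a : ZMod (2 * N), a ≠ 0 → ψ a ≠ 1 := by
    intro a ha h
    apply ha
    apply ZMod.injective_stdAddChar (N := 2 * N)
    rw [AddChar.map_zero_eq_one]; exact h
  have hL1 : ∀ w, ψ (L w) ≠ 1 := by
    intro w
    apply hne
    intro h
    have := hpar w
    rw [h, map_zero] at this
    exact absurd this (by decide)
  have hpow : ∀ a : ZMod (2 * N), ψ a ^ (2 * N) = 1 := by
    intro a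
    rw [← AddChar.map_nsmul_eq_pow, nsmul_eq_mul, CharP.cast_eq_zero, zero_mul,
      AddChar.map_zero_eq_one]
  have hψ0 : ∀ a, ψ a ≠ 0 := fun a h => by
    have := hpow a
    rw [h, zero_pow (NeZero.ne _)] at this
    exact zero_ne_one this
  have hQ : ψ (2 * L v) ≠ 1 := by
    apply hne
    intro h
    have h2 := congrArg (ZMod.castHom (dvd_mul_left N 2) (ZMod N)) h
    rw [map_mul, (hL v).1, map_zero, map_ofNat] at h2
    apply hv
    have hu : IsUnit ((2 : ℕ) : ZMod N) := by
      rw [ZMod.isUnit_iff_coprime]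
      exact Nat.coprime_two_left.mpr hN
    have h3 : ((2 : ℕ) : ZMod N) * v = 0 := by exact_mod_cast h2
    exact (hu.mul_right_eq_zero).mp h3
  have hshift : ∀ w, L (w + 2 * v) = 2 * L v + L w := by
    intro w
    apply aux_inj N hN
    · rw [map_add, map_mul, (hL _).1, (hL _).1, (hL _).1, map_ofNat]; ring
    · rw [map_add, map_mul, hpar, hpar, hpar, map_ofNat]; decide
  set Q := ψ (2 * L v) with hQdef
  let f : ZMod N → ℂ := fun w => (ψ (L w) + 1) / (ψ (L w) - 1)
  have hterm : ∀ s₁ s₂ α : ℕ,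
      e (((((s₁ : ZMod (2 * N)) * L (u + ((α : ZMod N) + 1) * v)
            - (s₂ : ZMod (2 * N)) * L (u + ((α : ZMod N) - 1) * v)).val : ℕ) : ℝ) / (2 * N : ℕ)) *
        (B1 ((s₁ : ℝ) / (2 * N : ℕ)) : ℂ) * (B1 ((s₂ : ℝ) / (2 * N : ℕ)) : ℂ)
      = (ψ (L (u + ((α : ZMod N) + 1) * v)) ^ s₁ * (B1 ((s₁ : ℝ) / (2 * N : ℕ)) : ℂ)) *
        ((ψ (L (u + ((α : ZMod N) - 1) * v)))⁻¹ ^ s₂ * (B1 ((s₂ : ℝ) / (2 * N : ℕ)) : ℂ)) := by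
    intro s₁ s₂ α
    rw [aux_e, AddChar.map_sub_eq_div, ← nsmul_eq_mul, ← nsmul_eq_mul, AddChar.map_nsmul_eq_pow,
      AddChar.map_nsmul_eq_pow, inv_pow]
    ring
  simp_rw [hterm]
  simp_rw [Finset.sum_comm (s := Finset.range (2 * N)) (t := Finset.range N)]
  simp_rw [← Finset.mul_sum, ← Finset.sum_mul]
  have hα : ∀ α : ZMod N,
      (∑ s ∈ Finset.range (2 * N), ψ (L (u + (α + 1) * v)) ^ s
          * (B1 ((s : ℝ) / (2 * N : ℕ)) : ℂ)) *
        (∑ s ∈ Finset.range (2 * N), (ψ (L (u + (α - 1) * v)))⁻¹ ^ s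
          * (B1 ((s : ℝ) / (2 * N : ℕ)) : ℂ))
      = -1 / 4 - 1 / 4 * ((Q + 1) / (1 - Q)) * (f (u + (α + 1) * v) - f (u + (α - 1) * v)) := by
    intro α
    have hb1 := hL1 (u + (α - 1) * v)
    have ha1 := hL1 (u + (α + 1) * v)
    have hb0 := hψ0 (L (u + (α - 1) * v))
    rw [aux_F _ (by omega) _ (hpow _) ha1,
      aux_F _ (by omega) _ (by rw [inv_pow, hpow, inv_one]) (by simpa using hb1)]
    have hw : u + (α + 1) * v = u + (α - 1) * v + 2 * v := by ring
    simp only [f]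
    have hZ : ψ (L (u + (α + 1) * v)) = Q * ψ (L (u + (α - 1) * v)) := by
      rw [hw, hshift, AddChar.map_add_eq_mul]
    rw [hZ] at ha1 ⊢
    clear hZ
    generalize ψ (L (u + (α - 1) * v)) = Y at *
    have e1 : Y - 1 ≠ 0 := sub_ne_zero.mpr hb1
    have e2 : Q * Y - 1 ≠ 0 := sub_ne_zero.mpr ha1
    have e3 : 1 - Q ≠ 0 := sub_ne_zero.mpr (Ne.symm hQ)
    have e4 : (Y⁻¹ + 1) / (2 * (Y⁻¹ - 1)) = - ((Y + 1) / (2 * (Y - 1))) := by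
      have e5 : Y⁻¹ - 1 = - (Y - 1) / Y := by field_simp; ring
      rw [e5]
      field_simp
      ring
    rw [e4]
    field_simp
    ring
  have := aux_sum N (fun α => (∑ s ∈ Finset.range (2 * N), ψ (L (u + (α + 1) * v)) ^ s
          * (B1 ((s : ℝ) / (2 * N : ℕ)) : ℂ)) *
        (∑ s ∈ Finset.range (2 * N), (ψ (L (u + (α - 1) * v)))⁻¹ ^ s
          * (B1 ((s : ℝ) / (2 * N : ℕ)) : ℂ)))
  rw [this, Finset.sum_congr rfl (fun α _ => hα α), Finset.sum_sub_distrib, ← Finset.mul_sum,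
    Finset.sum_sub_distrib]
  have hs : ∑ α : ZMod N, f (u + (α + 1) * v) = ∑ α : ZMod N, f (u + (α - 1) * v) := by
    rw [← Equiv.sum_comp (Equiv.addRight (2 : ZMod N)) (fun α => f (u + (α - 1) * v))]
    refine Finset.sum_congr rfl fun α _ => ?_
    simp only [Equiv.coe_addRight]
    congr 1
    ring
  rw [hs, sub_self, mul_zero, sub_zero, Finset.sum_const, Finset.card_univ, ZMod.card, nsmul_eq_mul]
  ring
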